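/- Let S ⊆ ℝⁿ (n ≥ 2) be a centrally symmetric convex body with C² boundary. There is a nonnegative function Φ with Φ(δ) → 0 as δ → 0 such that for all sufficiently small δ > 0, (1 − (1 + Φ(δ))·G_max·δ^{2/(n+1)})·S ⊆ S_δ. -/

import Mathlib

open MeasureTheory Metric Set Filter
open scoped RealInnerProductSpace Pointwise Topology

noncomputable section

abbrev Euc (n : ℕ) : Type := EuclideanSpace ℝ (Fin n)

/-- A centrally symmetric convex body in `ℝⁿ`. -/
def IsSymConvexBody {n : ℕ} (S : Set (Euc n)) : Prop :=
  IsCompact S ∧ Convex ℝ S ∧ (interior S).Nonempty ∧ S = -S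

/-- The convex floating body `K_δ`: the intersection of all closed halfspaces whose bounding
hyperplane cuts off a set of volume at most `δ·|K|ₙ` from `K`. -/
def floatingBody {n : ℕ} (K : Set (Euc n)) (δ : ℝ) : Set (Euc n) :=
  ⋂ (v : Euc n) (_ : v ≠ 0) (c : ℝ)
    (_ : volume (K ∩ {y | c ≤ ⟪v, y⟫}) ≤ ENNReal.ofReal δ * volume K),
    {y | ⟪v, y⟫ ≤ c}

/-- The illumination body `K^δ`. -/
def illuminationBody {n : ℕ} (K : Set (Euc n)) (δ : ℝ) : Set (Euc n) :=
  {x | volume (convexHull ℝ (K ∪ {x})) ≤ ENNReal.ofReal (1 + δ) * volume K}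

/-- The polar body `K°`. -/
def polarBody {n : ℕ} (K : Set (Euc n)) : Set (Euc n) :=
  {y | ∀ x ∈ K, ⟪x, y⟫ ≤ 1}

/-- The distance `d(C₁, C₂) = inf {a ≥ 1 : a⁻¹ C₁ ⊆ C₂ ⊆ a C₁}`. -/
def bodyDist {n : ℕ} (C₁ C₂ : Set (Euc n)) : ℝ :=
  sInf {a : ℝ | 1 ≤ a ∧ a⁻¹ • C₁ ⊆ C₂ ∧ C₂ ⊆ a • C₁}

/-- `d_C(δ) = inf_{δ' > 0} d(C_δ, ((C°)^{δ'})°)`. -/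
def dualDist {n : ℕ} (C : Set (Euc n)) (δ : ℝ) : ℝ :=
  sInf {r : ℝ | ∃ δ' > (0:ℝ), r = bodyDist (floatingBody C δ)
      (polarBody (illuminationBody (polarBody C) δ'))}

/-- `ν` is an outer unit normal of `S` at `x`. -/
def IsOuterNormalAt {n : ℕ} (S : Set (Euc n)) (x ν : Euc n) : Prop :=
  ‖ν‖ = 1 ∧ ∀ y ∈ S, ⟪y, ν⟫ ≤ ⟪x, ν⟫

/-- Near `x ∈ ∂S`, the boundary of `S` is the graph of a `C²` function `f` over the tangent
hyperplane at `x` (embedded via a linear isometry `L` orthogonal to the normal `ν`), with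
`f 0 = 0` and vanishing derivative at `0`, and `k` is the determinant of the Hessian of `f`
at `0`, i.e. the Gauss curvature of `∂S` at `x`. -/
def IsGaussCurvatureAt {n : ℕ} (S : Set (Euc n)) (x ν : Euc n) (k : ℝ) : Prop :=
  ∃ (L : Euc (n-1) →ₗᵢ[ℝ] Euc n) (f : Euc (n-1) → ℝ) (τ ε : ℝ),
    0 < τ ∧ 0 < ε ∧
    (∀ v, ⟪L v, ν⟫ = 0) ∧
    ContDiffOn ℝ 2 f (ball 0 τ) ∧
    f 0 = 0 ∧ fderiv ℝ f 0 = 0 ∧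
    frontier S ∩ ball x ε
      = {y | ∃ v ∈ ball (0 : Euc (n-1)) τ, y = x + L v - f v • ν} ∩ ball x ε ∧
    k = (Matrix.of fun i j : Fin (n-1) =>
      iteratedFDeriv ℝ 2 f 0 ![EuclideanSpace.single i 1, EuclideanSpace.single j 1]).det

/-- `S` has `C²` boundary, with outer unit normal map `u` and Gauss curvature function `κ`. -/
def IsC2Body {n : ℕ} (S : Set (Euc n)) (u : Euc n → Euc n) (κ : Euc n → ℝ) : Prop :=
  ∀ x ∈ frontier S, IsOuterNormalAt S x (u x) ∧ IsGaussCurvatureAt S x (u x) (κ x)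

/-- The constant `c(K, n) = ((n+1)^{2/(n+1)}/2)·(|K|ₙ/|B₂^{n−1}|_{n−1})^{2/(n+1)}`. -/
def cConst (n : ℕ) (K : Set (Euc n)) : ℝ :=
  ((n + 1 : ℝ) ^ ((2:ℝ)/(n+1)) / 2) *
    ((volume K).toReal / (volume (ball (0 : Euc (n-1)) 1)).toReal) ^ ((2:ℝ)/(n+1))

/-- The function `G_S(x) = c(S,n)·κ(x)^{1/(n+1)} / ⟨x, u(x)⟩`. -/
def Gfun {n : ℕ} (S : Set (Euc n)) (u : Euc n → Euc n) (κ : Euc n → ℝ) (x : Euc n) : ℝ :=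
  cConst n S * (κ x) ^ ((1:ℝ)/(n+1)) / ⟪x, u x⟫

section Calculus

variable {E : Type*} [NormedAddCommGroup E] [NormedSpace ℝ E]

theorem ContDiffOn.hasFDerivAt_fderiv_of_isOpen {f : E → ℝ} {U : Set E} (hU : IsOpen U)
    (hf : ContDiffOn ℝ 2 f U) {z : E} (hz : z ∈ U) :
    HasFDerivAt f (fderiv ℝ f z) z ∧
      HasFDerivAt (fderiv ℝ f) (fderiv ℝ (fderiv ℝ f) z) z ∧
      ContinuousAt (fderiv ℝ (fderiv ℝ f)) z := by
  have h := hf.contDiffAt (hU.mem_nhds hz)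
  have h1 : ContDiffAt ℝ 1 (fderiv ℝ f) z := h.fderiv_right (by norm_num)
  have h2 : ContDiffAt ℝ 0 (fderiv ℝ (fderiv ℝ f)) z := h1.fderiv_right (by norm_num)
  exact ⟨(h.differentiableAt (by norm_num)).hasFDerivAt,
    (h1.differentiableAt (by norm_num)).hasFDerivAt, h2.continuousAt⟩

/-- Second order Taylor upper bound on an interval. -/
theorem le_taylor_two_of_deriv_le {g g' g'' : ℝ → ℝ} {c : ℝ}
    (hg : ∀ t ∈ Icc (0 : ℝ) 1, HasDerivAt g (g' t) t)
    (hg' : ∀ t ∈ Icc (0 : ℝ) 1, HasDerivAt g' (g'' t) t)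
    (hc : ∀ t ∈ Icc (0 : ℝ) 1, g'' t ≤ c) :
    g 1 ≤ g 0 + g' 0 + c / 2 := by
  have mono : ∀ φ φ' : ℝ → ℝ, (∀ t ∈ Icc (0 : ℝ) 1, HasDerivAt φ (φ' t) t) →
      (∀ t ∈ Icc (0 : ℝ) 1, 0 ≤ φ' t) → MonotoneOn φ (Icc 0 1) := by
    intro φ φ' h h0
    refine monotoneOn_of_deriv_nonneg (convex_Icc 0 1)
      (fun t ht => (h t ht).continuousAt.continuousWithinAt)
      (fun t ht => (h t (interior_subset ht)).differentiableAt.differentiableWithinAt)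
      (fun t ht => ?_)
    rw [(h t (interior_subset ht)).deriv]
    exact h0 t (interior_subset ht)
  have h1 := mono (fun t => c * t - g' t) (fun t => c - g'' t)
    (fun t ht => by
      simpa using ((hasDerivAt_id' t).const_mul c).fun_sub (hg' t ht))
    (fun t ht => sub_nonneg.2 (hc t ht))
  have h2 := mono (fun t => g' 0 * t + c * t ^ 2 / 2 - g t) (fun t => g' 0 + c * t - g' t)
    (fun t ht => by
      have := (((hasDerivAt_id' t).const_mul (g' 0)).fun_add
        ((((hasDerivAt_id' t).fun_pow 2).const_mul c).div_const 2)).fun_sub (hg t ht)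
      refine this.congr_deriv ?_
      norm_num
      ring)
    (fun t ht => by
      have := h1 (left_mem_Icc.2 zero_le_one) ht ht.1
      simp only [mul_zero, zero_sub] at this
      linarith)
  have := h2 (left_mem_Icc.2 zero_le_one) (right_mem_Icc.2 zero_le_one) zero_le_one
  norm_num at this
  linarith

theorem ContDiffOn.le_taylor_two {f : E → ℝ} {U : Set E} (hU : IsOpen U) (hUc : Convex ℝ U)
    (hf : ContDiffOn ℝ 2 f U) {v w : E} (hv : v ∈ U) (hvw : v + w ∈ U) {c : ℝ}
    (hc : ∀ z ∈ U, fderiv ℝ (fderiv ℝ f) z w w ≤ c) :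
    f (v + w) ≤ f v + fderiv ℝ f v w + c / 2 := by
  have hmem : ∀ t ∈ Icc (0 : ℝ) 1, v + t • w ∈ U := fun t ht => by
    have := hUc.add_smul_sub_mem hv hvw ht
    simpa using this
  have hline : ∀ t : ℝ, HasDerivAt (fun t : ℝ => v + t • w) w t := fun t => by
    simpa using ((hasDerivAt_id t).smul_const w).const_add v
  have := le_taylor_two_of_deriv_le (g := fun t => f (v + t • w))
    (g' := fun t => fderiv ℝ f (v + t • w) w)
    (g'' := fun t => fderiv ℝ (fderiv ℝ f) (v + t • w) w w) (c := c)
    (fun t ht => ((hf.hasFDerivAt_fderiv_of_isOpen hU (hmem t ht)).1).comp_hasDerivAt t (hline t))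
    (fun t ht => by
      have := ((hf.hasFDerivAt_fderiv_of_isOpen hU (hmem t ht)).2.1).comp_hasDerivAt t (hline t)
      simpa using this.clm_apply (hasDerivAt_const t w))
    (fun t ht => hc _ (hmem t ht))
  simpa using this

/-- A quadratic upper bound for a `C²` function near a critical zero bounds its Hessian there. -/
theorem fderiv_fderiv_le_of_eventually_le {f : E → ℝ} {τ : ℝ} (hτ : 0 < τ)
    (hf : ContDiffOn ℝ 2 f (ball 0 τ)) (h0 : f 0 = 0) (h0' : fderiv ℝ f 0 = 0) (v : E) {a : ℝ}
    (h : ∀ᶠ t in 𝓝[>] (0 : ℝ), f (t • v) ≤ a * t ^ 2) :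
    fderiv ℝ (fderiv ℝ f) 0 v v ≤ 2 * a := by
  by_contra! hlt
  obtain ⟨b, hb, hb'⟩ := exists_between hlt
  have hcont : ContinuousAt (fun z => fderiv ℝ (fderiv ℝ f) z v v) 0 :=
    (((hf.hasFDerivAt_fderiv_of_isOpen isOpen_ball (mem_ball_self hτ)).2.2).clm_apply
      continuousAt_const).clm_apply continuousAt_const
  obtain ⟨σ, hσ, hσb⟩ := Metric.eventually_nhds_iff_ball.1 (hcont.eventually (lt_mem_nhds hb'))
  set σ' := min σ τ
  have hσ' : 0 < σ' := lt_min hσ hτ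
  have hsm : ∀ᶠ t in 𝓝[>] (0 : ℝ), t • v ∈ ball (0 : E) σ' := by
    have : ContinuousAt (fun t : ℝ => t • v) 0 := by fun_prop
    refine (this.mono_left nhdsWithin_le_nhds).eventually ?_
    simp only [zero_smul]
    exact ball_mem_nhds (0 : E) hσ'
  obtain ⟨t, ⟨ht1, ht2⟩, ht0⟩ := ((h.and hsm).and self_mem_nhdsWithin).exists
  have ht0 : (0 : ℝ) < t := ht0
  have hf' : ContDiffOn ℝ 2 (fun z => - f z) (ball 0 σ') :=
    (hf.mono (ball_subset_ball (min_le_right _ _))).neg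
  have hd : fderiv ℝ (fun z => - f z) = fun z => - fderiv ℝ f z := by
    ext1 z; exact fderiv_neg
  have hd2 : ∀ z, fderiv ℝ (fderiv ℝ fun z => - f z) z = - fderiv ℝ (fderiv ℝ f) z := by
    intro z; rw [hd]; exact fderiv_neg
  have := hf'.le_taylor_two isOpen_ball (convex_ball _ _) (v := 0) (w := t • v)
    (mem_ball_self hσ') (by simpa using ht2) (c := - b * t ^ 2) (fun z hz => by
      rw [hd2]
      have := hσb z (ball_subset_ball (min_le_left _ _) hz)
      simp only [neg_apply, map_smul, smul_apply, smul_eq_mul]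
      nlinarith [mul_pos ht0 ht0])
  rw [hd] at this
  simp [h0, h0'] at this
  nlinarith [mul_pos ht0 ht0]

theorem ContinuousAt.eventually_norm_sub_lt {X G : Type*} [TopologicalSpace X]
    [SeminormedAddCommGroup G] {g : X → G} {x : X} (h : ContinuousAt g x) {η : ℝ} (hη : 0 < η) :
    ∀ᶠ z in 𝓝 x, ‖g z - g x‖ < η := by
  filter_upwards [h.eventually (Metric.ball_mem_nhds _ hη)] with z hz using mem_ball_iff_norm.1 hz

end Calculus

section Charts

variable {n : ℕ} {E : Type*} [NormedAddCommGroup E] [InnerProductSpace ℝ E]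

/-- An isometry onto a hyperplane and a unit normal of it give an isometry of the product. -/
theorem exists_linearIsometryEquiv_prod {F : Type*} [NormedAddCommGroup F] [InnerProductSpace ℝ F]
    [FiniteDimensional ℝ E] [FiniteDimensional ℝ F]
    (hdim : Module.finrank ℝ F = Module.finrank ℝ E + 1)
    (L : E →ₗᵢ[ℝ] F) {ν : F} (hν : ‖ν‖ = 1) (hL : ∀ v, ⟪L v, ν⟫ = 0) :
    ∃ Ψ : WithLp 2 (E × ℝ) ≃ₗᵢ[ℝ] F, ∀ w a, Ψ (WithLp.toLp 2 (w, a)) = L w + a • ν := by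
  let T : WithLp 2 (E × ℝ) →ₗ[ℝ] F :=
    { toFun := fun p => L p.fst + p.snd • ν
      map_add' := fun p q => by simp [add_smul]; abel
      map_smul' := fun c p => by simp [smul_smul] }
  have hT : ∀ p, ‖T p‖ = ‖p‖ := fun p => by
    have h1 : ‖T p‖ ^ 2 = ‖p‖ ^ 2 := by
      change ‖L p.fst + p.snd • ν‖ ^ 2 = _
      rw [norm_add_sq_real, WithLp.prod_norm_sq_eq_of_L2, inner_smul_right, hL, norm_smul, hν]
      simp
    exact (sq_eq_sq₀ (norm_nonneg _) (norm_nonneg _)).1 h1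
  have hfin : Module.finrank ℝ (WithLp 2 (E × ℝ)) = Module.finrank ℝ F := by
    rw [hdim, (WithLp.linearEquiv 2 ℝ (E × ℝ)).finrank_eq, Module.finrank_prod,
      Module.finrank_self]
  exact ⟨LinearIsometry.toLinearIsometryEquiv ⟨T, hT⟩ hfin, fun w a => rfl⟩

/-- Near `x`, the boundary of `S` is the graph of the `C²` function `f` over the hyperplane
orthogonal to the outer normal `ν`. -/
structure IsGraphChart (S : Set (Euc n)) (x ν : Euc n) (L : E →ₗᵢ[ℝ] Euc n) (f : E → ℝ)
    (τ : ℝ) : Prop where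
  pos : 0 < τ
  normal : IsOuterNormalAt S x ν
  orth : ∀ v, ⟪L v, ν⟫ = 0
  contDiffOn : ContDiffOn ℝ 2 f (ball 0 τ)
  zero : f 0 = 0
  fderiv_zero : fderiv ℝ f 0 = 0
  mem_frontier : ∀ w ∈ ball (0 : E) τ, x + L w - f w • ν ∈ frontier S
  exists_of_mem : ∀ y ∈ frontier S, ‖y - x‖ < τ → ∃ v ∈ ball (0 : E) τ, y = x + L v - f v • ν

variable {S : Set (Euc n)} {x ν : Euc n} {L : E →ₗᵢ[ℝ] Euc n} {f : E → ℝ} {τ : ℝ}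

theorem norm_le_norm_sub_of_orth (orth : ∀ v, ⟪L v, ν⟫ = 0) (v : E) (a : ℝ) :
    ‖v‖ ≤ ‖x + L v - a • ν - x‖ := by
  rw [show x + L v - a • ν - x = L v - a • ν by abel,
    ← sq_le_sq₀ (norm_nonneg _) (norm_nonneg _), norm_sub_sq_real, inner_smul_right, orth, L.norm_map]
  nlinarith [sq_nonneg ‖a • ν‖]

theorem IsGaussCurvatureAt.exists_isGraphChart {k : ℝ} (hν : IsOuterNormalAt S x ν)
    (h : IsGaussCurvatureAt S x ν k) :
    ∃ (L : Euc (n - 1) →ₗᵢ[ℝ] Euc n) (f : Euc (n - 1) → ℝ) (τ : ℝ), IsGraphChart S x ν L f τ ∧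
      k = (Matrix.of fun i j : Fin (n - 1) =>
        fderiv ℝ (fderiv ℝ f) 0 (EuclideanSpace.single i 1) (EuclideanSpace.single j 1)).det := by
  obtain ⟨L, f, τ, ε, hτ, hε, hL, hf, h0, h0', hfr, hk⟩ := h
  have hfc : ContinuousAt f 0 :=
    (hf.hasFDerivAt_fderiv_of_isOpen isOpen_ball (mem_ball_self hτ)).1.continuousAt
  have hP : ContinuousAt (fun w => x + L w - f w • ν) 0 :=
    ((continuousAt_const.add L.continuous.continuousAt)).sub (hfc.smul continuousAt_const)
  have hP0 : ∀ᶠ w in 𝓝 (0 : Euc (n - 1)), x + L w - f w • ν ∈ ball x ε := by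
    refine hP.eventually ?_
    simp only [map_zero, h0, zero_smul, add_zero, sub_zero]
    exact ball_mem_nhds x hε
  obtain ⟨σ, hσ, hσP⟩ := Metric.eventually_nhds_iff_ball.1 hP0
  refine ⟨L, f, min (min σ τ) ε, ⟨by positivity, hν, hL, hf.mono (ball_subset_ball ?_), h0, h0',
    fun w hw => ?_, fun y hy hyx => ?_⟩, ?_⟩
  · exact (min_le_left _ _).trans (min_le_right _ _)
  · have h1 := hσP w (ball_subset_ball ((min_le_left _ _).trans (min_le_left _ _)) hw)
    have h2 := ball_subset_ball ((min_le_left _ _).trans (min_le_right _ _)) hw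
    exact (hfr.symm.subset ⟨⟨w, h2, rfl⟩, h1⟩).1
  · have : y ∈ frontier S ∩ ball x ε :=
      ⟨hy, by rw [mem_ball_iff_norm]; exact hyx.trans_le (min_le_right _ _)⟩
    rw [hfr] at this
    obtain ⟨⟨v, hv, rfl⟩, -⟩ := this
    refine ⟨v, ?_, rfl⟩
    rw [mem_ball_zero_iff]
    exact (norm_le_norm_sub_of_orth hL v _).trans_lt hyx
  · simpa only [iteratedFDeriv_two_apply, Matrix.cons_val_zero, Matrix.cons_val_one] using hk

theorem IsOuterNormalAt.norm_eq {N : Euc n} (h : IsOuterNormalAt S x N) : ‖N‖ = 1 := h.1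

theorem IsOuterNormalAt.inner_le {N y : Euc n} (h : IsOuterNormalAt S x N) (hy : y ∈ S) :
    ⟪y, N⟫ ≤ ⟪x, N⟫ := h.2 y hy

theorem IsSymConvexBody.isClosed (hS : IsSymConvexBody S) : IsClosed S := hS.1.isClosed

theorem IsSymConvexBody.frontier_subset (hS : IsSymConvexBody S) : frontier S ⊆ S :=
  hS.isClosed.frontier_subset

theorem IsGraphChart.inner_map_eq (h : IsGraphChart S x ν L f τ) (hS : IsSymConvexBody S)
    {v : E} (hv : v ∈ ball (0 : E) τ) {N : Euc n}
    (hN : IsOuterNormalAt S (x + L v - f v • ν) N) (w : E) :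
    ⟪L w, N⟫ = fderiv ℝ f v w * ⟪ν, N⟫ := by
  have hmax : IsLocalMax (fun z => ⟪x + L z - f z • ν, N⟫) v := by
    filter_upwards [isOpen_ball.mem_nhds hv] with z hz
    exact hN.inner_le (hS.frontier_subset (h.mem_frontier z hz))
  have hd := (h.contDiffOn.hasFDerivAt_fderiv_of_isOpen isOpen_ball hv).1
  have hd' : HasFDerivAt (fun z => x + L z - f z • ν)
      (L.toContinuousLinearMap - (fderiv ℝ f v).smulRight ν) v :=
    (L.toContinuousLinearMap.hasFDerivAt.const_add x).fun_sub (hd.smul_const ν)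
  have hd2 := hd'.inner ℝ (hasFDerivAt_const N v)
  have := congrArg (fun T => T w) (hmax.hasFDerivAt_eq_zero hd2)
  simp [inner_sub_left, inner_smul_left] at this
  linarith

theorem IsGraphChart.eq_normal [FiniteDimensional ℝ E] (hn : n = Module.finrank ℝ E + 1)
    (h : IsGraphChart S x ν L f τ) (hS : IsSymConvexBody S) {N : Euc n}
    (hN : IsOuterNormalAt S x N) : N = ν := by
  have horth : ∀ w, ⟪L w, N⟫ = 0 := fun w => by
    have := h.inner_map_eq hS (mem_ball_self h.pos) (N := N)
      (by simpa [h.zero] using hN) w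
    simpa [h.fderiv_zero] using this
  obtain ⟨Ψ, hΨ⟩ := exists_linearIsometryEquiv_prod (by simpa using hn) L h.normal.norm_eq h.orth
  obtain ⟨⟨⟨w, a⟩⟩, rfl⟩ := Ψ.surjective N
  rw [hΨ] at hN horth ⊢
  have hw : w = 0 := by
    have := horth w
    rw [inner_add_right, inner_smul_right, h.orth, LinearIsometry.inner_map_map,
      real_inner_self_eq_norm_sq] at this
    simpa using this
  subst hw
  rw [map_zero, zero_add] at hN ⊢
  have ha : |a| = 1 := by simpa [norm_smul, h.normal.norm_eq] using hN.norm_eq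
  rcases (abs_eq zero_le_one).1 ha with rfl | rfl
  · exact one_smul _ _
  · exfalso
    have hconst : ∀ y ∈ S, ⟪y, ν⟫ = ⟪x, ν⟫ := fun y hy =>
      le_antisymm (h.normal.inner_le hy) (by simpa using hN.inner_le hy)
    obtain ⟨p, hp⟩ := hS.2.2.1
    have hc : ContinuousAt (fun s : ℝ => p + s • ν) 0 := by fun_prop
    have hev : ∀ᶠ s in 𝓝 (0 : ℝ), p + s • ν ∈ S := by
      refine hc.eventually ?_
      simpa using mem_interior_iff_mem_nhds.1 hp
    obtain ⟨s, hs, hs0⟩ := ((hev.filter_mono nhdsWithin_le_nhds).and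
      (self_mem_nhdsWithin (a := (0 : ℝ)) (s := Ioi 0))).exists
    have h1 := hconst _ hs
    rw [inner_add_left, hconst p (interior_subset hp), inner_smul_left,
      real_inner_self_eq_norm_sq, h.normal.norm_eq] at h1
    have hs0 : 0 < s := hs0
    norm_num at h1
    exact hs0.ne' h1

theorem IsGraphChart.exists_sub_smul_mem_interior [FiniteDimensional ℝ E]
    (hn : n = Module.finrank ℝ E + 1)
    (h : IsGraphChart S x ν L f τ) (hS : IsSymConvexBody S) :
    ∃ s > (0 : ℝ), x - s • ν ∈ interior S := by
  by_contra! hno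
  have hx : x ∈ frontier S := by
    simpa [h.zero] using h.mem_frontier 0 (mem_ball_self h.pos)
  have hdisj : Disjoint (interior S) ((fun s : ℝ => x - s • ν) '' Ici 0) := by
    rw [Set.disjoint_left]
    rintro _ hy ⟨s, hs, rfl⟩
    rcases (show (0 : ℝ) ≤ s from hs).eq_or_lt with rfl | hs
    · exact hx.2 (by simpa using hy)
    · exact hno s hs hy
  have hconv : Convex ℝ ((fun s : ℝ => x - s • ν) '' Ici 0) := by
    have := ((convex_Ici (𝕜 := ℝ) (0 : ℝ)).linear_image
      (LinearMap.toSpanSingleton ℝ _ (-ν))).translate x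
    rw [image_image] at this
    simpa [sub_eq_add_neg] using this
  obtain ⟨φ, c, hφ, hφ'⟩ := geometric_hahn_banach_open hS.2.1.interior isOpen_interior hconv hdisj
  have hle : ∀ y ∈ S, φ y ≤ c := by
    intro y hy
    have : y ∈ closure (interior S) := by
      rw [hS.2.1.closure_interior_eq_closure_of_nonempty_interior hS.2.2.1]
      exact subset_closure hy
    exact closure_minimal (fun z hz => (hφ z hz).le)
      (isClosed_le φ.continuous continuous_const) this
  have hxc : c ≤ φ x := hφ' x ⟨0, self_mem_Ici, by simp⟩
  have h1 := hφ' _ ⟨1, mem_Ici.2 zero_le_one, rfl⟩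
  obtain ⟨p, hp⟩ := hS.2.2.1
  set N₀ := (InnerProductSpace.toDual ℝ (Euc n)).symm φ
  have hN₀ : ∀ y, ⟪N₀, y⟫ = φ y := fun y => InnerProductSpace.toDual_symm_apply
  have hne : N₀ ≠ 0 := by
    intro h0
    have e1 := hφ p hp
    rw [← hN₀, h0, inner_zero_left] at e1
    rw [← hN₀, h0, inner_zero_left] at hxc
    linarith
  have hpos : 0 < ‖N₀‖ := norm_pos_iff.2 hne
  have hN : IsOuterNormalAt S x (‖N₀‖⁻¹ • N₀) := by
    refine ⟨by simp [norm_smul, hne], fun y hy => ?_⟩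
    rw [inner_smul_right, inner_smul_right, real_inner_comm N₀ y, real_inner_comm N₀ x, hN₀, hN₀]
    exact mul_le_mul_of_nonneg_left ((hle y hy).trans hxc) (by positivity)
  have hEq := h.eq_normal hn hS hN
  have hν : φ ν = ‖N₀‖ := by
    rw [← hN₀, ← hEq, inner_smul_right, real_inner_self_eq_norm_sq]
    field_simp
  have := hle x (hS.frontier_subset hx)
  rw [map_sub, map_smul, hν] at h1
  simp at h1
  linarith

theorem IsGraphChart.nonneg (h : IsGraphChart S x ν L f τ) (hS : IsSymConvexBody S) {w : E}
    (hw : w ∈ ball (0 : E) τ) : 0 ≤ f w := by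
  have := h.normal.inner_le (hS.frontier_subset (h.mem_frontier w hw))
  rw [inner_sub_left, inner_add_left, h.orth, inner_smul_left, real_inner_self_eq_norm_sq,
    h.normal.norm_eq] at this
  simp at this
  linarith

theorem eventually_smul_mem_ball (hτ : 0 < τ) (v : E) :
    ∀ᶠ t in 𝓝[>] (0 : ℝ), t • v ∈ ball (0 : E) τ := by
  have : ContinuousAt (fun t : ℝ => t • v) 0 := by fun_prop
  refine (this.mono_left nhdsWithin_le_nhds).eventually ?_
  simp only [zero_smul]
  exact ball_mem_nhds (0 : E) hτ

theorem IsGraphChart.hessian_le (h : IsGraphChart S x ν L f τ) {a : ℝ} {v : E}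
    (hle : ∀ᶠ t in 𝓝[>] (0 : ℝ), f (t • v) ≤ a * t ^ 2) :
    fderiv ℝ (fderiv ℝ f) 0 v v ≤ 2 * a :=
  fderiv_fderiv_le_of_eventually_le h.pos h.contDiffOn h.zero h.fderiv_zero v hle

theorem IsGraphChart.le_hessian (h : IsGraphChart S x ν L f τ) {a : ℝ} {v : E}
    (hle : ∀ᶠ t in 𝓝[>] (0 : ℝ), a * t ^ 2 ≤ f (t • v)) :
    2 * a ≤ fderiv ℝ (fderiv ℝ f) 0 v v := by
  have hd : fderiv ℝ (fun z => - f z) = fun z => - fderiv ℝ f z := by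
    ext1 z; exact fderiv_neg
  have := fderiv_fderiv_le_of_eventually_le h.pos h.contDiffOn.neg (by simp [h.zero])
    (by simp [h.fderiv_zero]) v (a := -a) (hle.mono fun t ht => by simpa using ht)
  rw [hd, fderiv_fun_neg] at this
  simp at this
  linarith

theorem IsGraphChart.hessian_nonneg (h : IsGraphChart S x ν L f τ) (hS : IsSymConvexBody S)
    (v : E) : 0 ≤ fderiv ℝ (fderiv ℝ f) 0 v v := by
  have := h.le_hessian (a := 0) (v := v) ((eventually_smul_mem_ball h.pos v).mono fun t ht => by
    simpa using h.nonneg hS ht)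
  simpa using this

/-- Near a boundary point, `S` contains a paraboloid, whose curvature is close to that of the
boundary at this point, touching the boundary at every nearby point. -/
theorem IsGraphChart.exists_paraboloid_subset [FiniteDimensional ℝ E]
    (hn : n = Module.finrank ℝ E + 1)
    (h : IsGraphChart S x ν L f τ) (hS : IsSymConvexBody S) {η : ℝ} (hη : 0 < η) :
    ∃ ρ > (0 : ℝ), ∃ t₀ > (0 : ℝ), ∀ y ∈ frontier S, ‖y - x‖ < ρ → ∀ N, IsOuterNormalAt S y N →
      ∃ l : E →L[ℝ] ℝ, ‖l‖ ≤ 1 ∧ (∀ w, ⟪L w, N⟫ = l w * ⟪ν, N⟫) ∧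
        ∀ w s, (fderiv ℝ (fderiv ℝ f) 0 w w + η * ‖w‖ ^ 2) / 2 ≤ s → s ≤ t₀ →
          y + L w - (l w + s) • ν ∈ S := by
  obtain ⟨b, hb, hbS⟩ := h.exists_sub_smul_mem_interior hn hS
  obtain ⟨r, hr, hrS⟩ := Metric.mem_nhds_iff.1 (mem_interior_iff_mem_nhds.1 hbS)
  obtain ⟨hd, hd1, hd2⟩ :=
    h.contDiffOn.hasFDerivAt_fderiv_of_isOpen isOpen_ball (mem_ball_self h.pos)
  have e1 : ∀ᶠ z in 𝓝 (0 : E), f z < b / 3 :=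
    hd.continuousAt.eventually (gt_mem_nhds (by rw [h.zero]; positivity))
  have e2 : ∀ᶠ z in 𝓝 (0 : E), ‖fderiv ℝ f z‖ < 1 :=
    hd1.continuousAt.norm.eventually (gt_mem_nhds (by simp [h.fderiv_zero]))
  have e3 : ∀ᶠ z in 𝓝 (0 : E), ‖fderiv ℝ (fderiv ℝ f) z - fderiv ℝ (fderiv ℝ f) 0‖ < η :=
    ContinuousAt.eventually_norm_sub_lt (G := E →L[ℝ] E →L[ℝ] ℝ) hd2 hη
  obtain ⟨σ₀, hσ₀, hσ₀'⟩ := Metric.eventually_nhds_iff_ball.1 ((e1.and e2).and e3)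
  set σ := min σ₀ (min τ r)
  have hσ : 0 < σ := lt_min hσ₀ (lt_min h.pos hr)
  have hστ : σ ≤ τ := (min_le_right _ _).trans (min_le_left _ _)
  have hσr : σ ≤ r := (min_le_right _ _).trans (min_le_right _ _)
  set μ := min (σ / 2) (b / 3)
  have hμ : 0 < μ := lt_min (by positivity) (by positivity)
  refine ⟨σ / 2, by positivity, min (η * μ ^ 2 / 4) (b / 3), by positivity, ?_⟩
  intro y hy hyx N hN
  obtain ⟨v, hv, rfl⟩ := h.exists_of_mem y hy (by linarith)
  have hvσ : ‖v‖ < σ / 2 := (norm_le_norm_sub_of_orth h.orth v _).trans_lt hyx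
  have hvσ₀ : v ∈ ball (0 : E) σ₀ := by
    rw [mem_ball_zero_iff]; linarith [min_le_left σ₀ (min τ r)]
  obtain ⟨⟨hv1, hv2⟩, -⟩ := hσ₀' v hvσ₀
  refine ⟨fderiv ℝ f v, hv2.le, h.inner_map_eq hS hv hN, fun w s hs hs₀ => ?_⟩
  have hwμ : ‖w‖ < μ := by
    have h1 := h.hessian_nonneg hS w
    have h2 : η * ‖w‖ ^ 2 / 2 ≤ η * μ ^ 2 / 4 := by
      linarith [min_le_left (η * μ ^ 2 / 4) (b / 3)]
    have h3 : ‖w‖ ^ 2 < μ ^ 2 := by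
      by_contra! hle
      have := mul_le_mul_of_nonneg_left hle hη.le
      nlinarith [mul_pos hη (pow_pos hμ 2)]
    exact lt_of_pow_lt_pow_left₀ 2 hμ.le h3
  have hvw : ‖v + w‖ < σ := by
    linarith [norm_add_le v w, min_le_left (σ / 2) (b / 3)]
  have hT := (h.contDiffOn.mono (ball_subset_ball hστ)).le_taylor_two isOpen_ball
    (convex_ball _ _) (v := v) (w := w) (by rw [mem_ball_zero_iff]; linarith)
    (by rwa [mem_ball_zero_iff])
    (c := fderiv ℝ (fderiv ℝ f) 0 w w + η * ‖w‖ ^ 2) (fun z hz => by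
      have h1 := (hσ₀' z (ball_subset_ball (min_le_left _ _) hz)).2
      have h2 := le_trans (le_abs_self _) ((fderiv ℝ (fderiv ℝ f) z
        - fderiv ℝ (fderiv ℝ f) 0).le_opNorm₂ w w)
      simp only [sub_apply] at h2
      nlinarith [mul_le_mul_of_nonneg_right h1.le (sq_nonneg ‖w‖)])
  have hlw : fderiv ℝ f v w ≤ b / 3 := by
    have h1 := le_trans (le_abs_self _) ((fderiv ℝ f v).le_opNorm w)
    have h2 := mul_le_mul_of_nonneg_right hv2.le (norm_nonneg w)
    linarith [min_le_right (σ / 2) (b / 3)]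
  have hs1 : s ≤ b / 3 := hs₀.trans (min_le_right _ _)
  have hoc : ((fun t : ℝ => x + L (v + w) - t • ν) ⁻¹' S).OrdConnected := by
    have : Convex ℝ ((fun t : ℝ => x + L (v + w) - t • ν) ⁻¹' S) := by
      have := (hS.2.1.translate_preimage_right (x + L (v + w))).linear_preimage
        (LinearMap.toSpanSingleton ℝ _ (-ν))
      simpa [preimage_preimage, sub_eq_add_neg] using this
    exact this.ordConnected
  have hm1 : f (v + w) ∈ (fun t : ℝ => x + L (v + w) - t • ν) ⁻¹' S :=
    hS.frontier_subset (h.mem_frontier _ (by rw [mem_ball_zero_iff]; linarith))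
  have hm2 : b ∈ (fun t : ℝ => x + L (v + w) - t • ν) ⁻¹' S := by
    refine hrS ?_
    rw [mem_ball_iff_norm]
    have : x + L (v + w) - b • ν - (x - b • ν) = L (v + w) := by abel
    rw [this, L.norm_map]
    linarith
  have := hoc.out hm1 hm2 (⟨by linarith, by linarith⟩ : f v + fderiv ℝ f v w + s ∈ Icc _ b)
  simp only [mem_preimage, map_add] at this
  convert this using 1
  module

end Charts

section Curvature

variable {n : ℕ} {E : Type*} [NormedAddCommGroup E] [InnerProductSpace ℝ E]
  {S : Set (Euc n)} {x ν : Euc n} {L : E →ₗᵢ[ℝ] Euc n} {f : E → ℝ} {τ : ℝ}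

/-- Locally uniform interior ball condition. -/
theorem IsGraphChart.exists_ball_subset [FiniteDimensional ℝ E]
    (hn : n = Module.finrank ℝ E + 1)
    (h : IsGraphChart S x ν L f τ) (hS : IsSymConvexBody S) :
    ∃ ρ > (0 : ℝ), ∃ r > (0 : ℝ), ∀ y ∈ frontier S, ‖y - x‖ < ρ → ∀ N, IsOuterNormalAt S y N →
      ball (y - r • N) r ⊆ S := by
  obtain ⟨ρ, hρ, t₀, ht₀, H⟩ := h.exists_paraboloid_subset hn hS one_pos
  set K := ‖fderiv ℝ (fderiv ℝ f) 0‖ + 1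
  have hK : 0 < K := by positivity
  refine ⟨ρ, hρ, min K⁻¹ (t₀ / 4), by positivity, fun y hy hyx N hN z hz => ?_⟩
  set r := min K⁻¹ (t₀ / 4)
  have hr : 0 < r := by positivity
  obtain ⟨l, hl, hlN, hlS⟩ := H y hy hyx N hN
  have hνN : 0 ≤ ⟪ν, N⟫ := by
    have h1 := hN.inner_le (hlS 0 t₀ (by simpa using ht₀.le) le_rfl)
    simp only [map_zero, add_zero, zero_add, inner_sub_left, inner_smul_left] at h1
    simp only [conj_trivial] at h1
    by_contra! hlt
    nlinarith [mul_pos_of_neg_of_neg hlt (neg_neg_of_pos ht₀)]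
  have hνN1 : ⟪ν, N⟫ ≤ 1 := by
    simpa [h.normal.norm_eq, hN.norm_eq] using real_inner_le_norm ν N
  obtain ⟨Ψ, hΨ⟩ := exists_linearIsometryEquiv_prod (by simpa using hn) L h.normal.norm_eq h.orth
  obtain ⟨⟨⟨w, a⟩⟩, hwa⟩ := Ψ.surjective (z - y)
  rw [hΨ] at hwa
  have hsq : ‖z - y‖ ^ 2 = ‖w‖ ^ 2 + a ^ 2 := by
    rw [← hwa, norm_add_sq_real, inner_smul_right, h.orth, L.norm_map, norm_smul,
      h.normal.norm_eq]
    simp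
  have hzN : ‖z - y + r • N‖ < r := by
    rwa [mem_ball_iff_norm, show z - (y - r • N) = z - y + r • N by abel] at hz
  have hzy : ‖z - y‖ < 2 * r := by
    have := norm_sub_le (z - y + r • N) (r • N)
    rw [add_sub_cancel_right, norm_smul, hN.norm_eq, Real.norm_of_nonneg hr.le] at this
    linarith
  have hin : ⟪z - y, N⟫ = (l w + a) * ⟪ν, N⟫ := by
    rw [← hwa, inner_add_left, inner_smul_left, hlN, conj_trivial]; ring
  have hmain : ‖z - y‖ ^ 2 + 2 * r * ((l w + a) * ⟪ν, N⟫) < 0 := by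
    have h1 := pow_lt_pow_left₀ hzN (norm_nonneg _) two_ne_zero
    rw [norm_add_sq_real, inner_smul_right, hin, norm_smul, hN.norm_eq,
      Real.norm_of_nonneg hr.le] at h1
    linarith
  set s := - (l w + a)
  have hs : l w + a = - s := by simp [s]
  rw [hs] at hmain
  have hs0 : 0 < s := by
    by_contra! hle
    have := mul_nonneg (mul_nonneg hr.le (neg_nonneg.2 hle)) hνN
    nlinarith [sq_nonneg ‖z - y‖]
  have hw2 : ‖w‖ ^ 2 ≤ 2 * r * s := by
    have := mul_le_mul_of_nonneg_left hνN1 (mul_pos hr hs0).le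
    nlinarith [sq_nonneg a]
  have hwn : ‖w‖ ≤ ‖z - y‖ :=
    le_of_sq_le_sq (by rw [hsq]; nlinarith [sq_nonneg a]) (norm_nonneg _)
  have han : |a| ≤ ‖z - y‖ :=
    abs_le_of_sq_le_sq' (by rw [hsq]; nlinarith [sq_nonneg ‖w‖]) (norm_nonneg _) |> abs_le.2
  have hst : s ≤ t₀ := by
    have h1 := le_trans (neg_le_abs _) (l.le_opNorm w)
    have h2 := mul_le_mul_of_nonneg_right hl (norm_nonneg w)
    have h3 := neg_le_abs a
    have h4 : r ≤ t₀ / 4 := min_le_right _ _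
    linarith
  have hQ : (fderiv ℝ (fderiv ℝ f) 0 w w + 1 * ‖w‖ ^ 2) / 2 ≤ s := by
    have h1 := le_trans (le_abs_self _) ((fderiv ℝ (fderiv ℝ f) 0).le_opNorm₂ w w)
    have h2 : K * r ≤ 1 := by
      have := mul_le_mul_of_nonneg_left (min_le_left K⁻¹ (t₀ / 4)) hK.le
      rwa [mul_inv_cancel₀ hK.ne'] at this
    have h3 := mul_le_mul_of_nonneg_left hw2 hK.le
    have h4 := mul_le_mul_of_nonneg_right h2 hs0.le
    have h5 : K * ‖w‖ ^ 2 = ‖fderiv ℝ (fderiv ℝ f) 0‖ * ‖w‖ * ‖w‖ + ‖w‖ ^ 2 := by ring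
    linarith
  have := hlS w s hQ hst
  convert this using 1
  have : z = y + (L w + a • ν) := by rw [hwa]; abel
  rw [this, show l w + s = - a by linarith]
  module

theorem IsGraphChart.hessian_le_of_ball_subset (h : IsGraphChart S x ν L f τ) {r : ℝ} (hr : 0 < r)
    (hb : ball (x - r • ν) r ⊆ S) (hS : IsSymConvexBody S) (v : E) :
    fderiv ℝ (fderiv ℝ f) 0 v v ≤ 2 * (‖v‖ ^ 2 / r) := by
  have hfc : ContinuousAt f 0 :=
    (h.contDiffOn.hasFDerivAt_fderiv_of_isOpen isOpen_ball
      (mem_ball_self h.pos)).1.continuousAt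
  obtain ⟨σ, hσ, hσf⟩ := Metric.eventually_nhds_iff_ball.1
    (hfc.eventually (gt_mem_nhds (by rw [h.zero]; exact hr)))
  refine h.hessian_le ?_
  filter_upwards [eventually_smul_mem_ball h.pos v, eventually_smul_mem_ball hσ v] with t h1 h2
  have h3 : x + L (t • v) - f (t • v) • ν ∉ ball (x - r • ν) r := fun hmem =>
    (h.mem_frontier _ h1).2 (interior_maximal hb isOpen_ball hmem)
  rw [mem_ball_iff_norm, not_lt, show x + L (t • v) - f (t • v) • ν - (x - r • ν) =
    L (t • v) + (r - f (t • v)) • ν by module] at h3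
  have h4 := pow_le_pow_left₀ hr.le h3 2
  rw [norm_add_sq_real, inner_smul_right, h.orth, L.norm_map, norm_smul, norm_smul,
    h.normal.norm_eq, mul_one, Real.norm_eq_abs, Real.norm_eq_abs, sq_abs, mul_pow, sq_abs] at h4
  rw [div_mul_eq_mul_div, le_div_iff₀ hr]
  nlinarith [h.nonneg hS h1, hσf _ h2]

theorem abs_det_le_of_quadratic_bounds {m : ℕ} (B : Euc m →L[ℝ] Euc m →L[ℝ] ℝ) {K : ℝ}
    (hsymm : ∀ v w, B v w = B w v) (h0 : ∀ v, 0 ≤ B v v) (hK : ∀ v, B v v ≤ K * ‖v‖ ^ 2) :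
    |(Matrix.of fun i j : Fin m =>
      B (EuclideanSpace.single i 1) (EuclideanSpace.single j 1)).det| ≤
      m.factorial * (2 * K) ^ m := by
  have := Matrix.det_le (A := Matrix.of fun i j : Fin m =>
      B (EuclideanSpace.single i 1) (EuclideanSpace.single j 1))
      (abv := AbsoluteValue.abs) (x := 2 * K) (fun i j => ?_)
  · simpa using this
  · have hi : ‖(EuclideanSpace.single i 1 : Euc m)‖ = 1 := by simp
    have hj : ‖(EuclideanSpace.single j 1 : Euc m)‖ = 1 := by simp
    simp only [Matrix.of_apply, AbsoluteValue.abs_apply]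
    set a : Euc m := EuclideanSpace.single i 1
    set b : Euc m := EuclideanSpace.single j 1
    have hK0 : 0 ≤ K := by
      have := (h0 a).trans (hK a)
      rwa [hi, one_pow, mul_one] at this
    have key : ∀ c : Euc m, ‖c‖ ≤ 2 → B c c ≤ 4 * K := fun c hc => by
      have := pow_le_pow_left₀ (norm_nonneg c) hc 2
      nlinarith [hK c]
    have h1 := key (a + b) ((norm_add_le _ _).trans (by rw [hi, hj]; norm_num))
    have h2 := key (a - b) ((norm_sub_le _ _).trans (by rw [hi, hj]; norm_num))
    simp only [map_add, map_sub, add_apply, sub_apply] at h1 h2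
    rw [hsymm b a] at h1 h2
    rw [abs_le]
    constructor <;> linarith [h0 a, h0 b]

theorem IsGraphChart.isSymm_hessian (h : IsGraphChart S x ν L f τ) (v w : E) :
    fderiv ℝ (fderiv ℝ f) 0 v w = fderiv ℝ (fderiv ℝ f) 0 w v :=
  (h.contDiffOn.contDiffAt (isOpen_ball.mem_nhds (mem_ball_self h.pos))).isSymmSndFDerivAt
    (by simp) v w

theorem IsGraphChart.exists_curvature_le [FiniteDimensional ℝ E]
    (hn : n = Module.finrank ℝ E + 1)
    (h : IsGraphChart S x ν L f τ) (hS : IsSymConvexBody S) :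
    ∃ ρ > (0 : ℝ), ∃ C : ℝ, ∀ y ∈ frontier S, ‖y - x‖ < ρ → ∀ N k, IsOuterNormalAt S y N →
      IsGaussCurvatureAt S y N k → |k| ≤ C := by
  obtain ⟨ρ, hρ, r, hr, H⟩ := h.exists_ball_subset hn hS
  refine ⟨ρ, hρ, (n - 1).factorial * (2 * (2 / r)) ^ (n - 1), fun y hy hyx N k hN hk => ?_⟩
  obtain ⟨L', f', τ', h', rfl⟩ := hk.exists_isGraphChart hN
  exact abs_det_le_of_quadratic_bounds _ h'.isSymm_hessian (h'.hessian_nonneg hS)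
    (K := 2 / r) (fun v => (h'.hessian_le_of_ball_subset hr (H y hy hyx N hN) hS v).trans_eq
      (by ring))

end Curvature

section Volume

/-- The volume of the paraboloid cap `‖T w‖² / 2 ≤ s ≤ t`. -/
theorem volume_paraboloid {E : Type*} [NormedAddCommGroup E] [InnerProductSpace ℝ E]
    [FiniteDimensional ℝ E] [MeasurableSpace E] [BorelSpace E] (T : E →ₗ[ℝ] E)
    (hT : LinearMap.det T ≠ 0) {t : ℝ} (ht : 0 ≤ t) :
    volume {p : E × ℝ | ‖T p.1‖ ^ 2 / 2 ≤ p.2 ∧ p.2 ≤ t} =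
      ENNReal.ofReal (|LinearMap.det T|⁻¹ * (volume (ball (0 : E) 1)).toReal *
        2 ^ ((Module.finrank ℝ E : ℝ) / 2) * t ^ ((Module.finrank ℝ E : ℝ) / 2 + 1) /
          ((Module.finrank ℝ E : ℝ) / 2 + 1)) := by
  set m := Module.finrank ℝ E
  set β := (volume (ball (0 : E) 1)).toReal
  have hTc : Continuous T := T.continuous_of_finiteDimensional
  have hmeas : MeasurableSet {p : E × ℝ | ‖T p.1‖ ^ 2 / 2 ≤ p.2 ∧ p.2 ≤ t} := by
    have h1 : Continuous fun p : E × ℝ => ‖T p.1‖ ^ 2 / 2 := by fun_prop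
    exact ((isClosed_le h1 continuous_snd).inter
      (isClosed_le continuous_snd continuous_const)).measurableSet
  have hslice : ∀ s : ℝ, volume ((fun w : E => (w, s)) ⁻¹'
      {p : E × ℝ | ‖T p.1‖ ^ 2 / 2 ≤ p.2 ∧ p.2 ≤ t}) =
      (Icc 0 t).indicator (fun s => ENNReal.ofReal
        (|LinearMap.det T|⁻¹ * β * 2 ^ ((m : ℝ) / 2) * s ^ ((m : ℝ) / 2))) s := by
    intro s
    by_cases hs : s ∈ Icc 0 t
    · rw [indicator_of_mem hs]
      have : ((fun w : E => (w, s)) ⁻¹' {p : E × ℝ | ‖T p.1‖ ^ 2 / 2 ≤ p.2 ∧ p.2 ≤ t}) =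
          T ⁻¹' closedBall 0 √(2 * s) := by
        ext w
        have : ‖T w‖ ≤ √(2 * s) ↔ ‖T w‖ ^ 2 / 2 ≤ s := by
          rw [Real.le_sqrt (norm_nonneg _) (by linarith [hs.1])]
          constructor <;> intro h <;> linarith
        rw [mem_preimage, mem_preimage, mem_closedBall_zero_iff, this]
        exact and_iff_left hs.2
      rw [this, Measure.addHaar_preimage_linearMap _ hT, Measure.addHaar_closedBall _ _
        (Real.sqrt_nonneg _), ← ENNReal.ofReal_toReal (measure_ball_lt_top (μ := volume)).ne,
        ← ENNReal.ofReal_mul (by positivity), ← ENNReal.ofReal_mul (by positivity), abs_inv]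
      congr 1
      rw [Real.sqrt_eq_rpow, ← Real.rpow_natCast, ← Real.rpow_mul (by linarith [hs.1]),
        Real.mul_rpow (by norm_num) hs.1, one_div_mul_eq_div]
      ring
    · rw [indicator_of_notMem hs]
      have : ((fun w : E => (w, s)) ⁻¹' {p : E × ℝ | ‖T p.1‖ ^ 2 / 2 ≤ p.2 ∧ p.2 ≤ t}) = ∅ := by
        ext w
        simp only [mem_preimage, mem_ofPred_eq, mem_empty_iff_false, iff_false]
        rintro ⟨h1, h2⟩
        exact hs ⟨le_trans (by positivity) h1, h2⟩
      rw [this, measure_empty]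
  rw [Measure.volume_eq_prod, Measure.prod_apply_symm hmeas]
  simp_rw [hslice]
  rw [lintegral_indicator measurableSet_Icc, ← ofReal_integral_eq_lintegral_ofReal]
  · rw [integral_Icc_eq_integral_Ioc, ← intervalIntegral.integral_of_le ht,
      intervalIntegral.integral_const_mul, integral_rpow (Or.inl (by
        have : (0 : ℝ) ≤ (m : ℝ) / 2 := by positivity
        linarith)), Real.zero_rpow (by positivity), sub_zero, mul_div_assoc]
  · refine ContinuousOn.integrableOn_Icc ?_
    exact continuousOn_const.mul (continuousOn_id.rpow_const fun x _ => Or.inr (by positivity))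
  · filter_upwards [ae_restrict_mem measurableSet_Icc] with s hs
    have := hs.1
    positivity

theorem measurePreserving_shear_frame {E F : Type*} [NormedAddCommGroup E] [InnerProductSpace ℝ E]
    [FiniteDimensional ℝ E] [MeasurableSpace E] [BorelSpace E]
    [NormedAddCommGroup F] [InnerProductSpace ℝ F]
    [FiniteDimensional ℝ F] [MeasurableSpace F] [BorelSpace F]
    (hdim : Module.finrank ℝ F = Module.finrank ℝ E + 1)
    (L : E →ₗᵢ[ℝ] F) {ν : F} (hν : ‖ν‖ = 1) (hL : ∀ v, ⟪L v, ν⟫ = 0) (y : F) (l : E →L[ℝ] ℝ) :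
    MeasurePreserving (fun p : E × ℝ => y + L p.1 - (l p.1 + p.2) • ν) := by
  obtain ⟨Ψ, hΨ⟩ := exists_linearIsometryEquiv_prod hdim L hν hL
  have h1 : MeasurePreserving (fun p : E × ℝ => (p.1, - (l p.1 + p.2))) := by
    refine (MeasurePreserving.id volume).skew_product (g := fun w s => - (l w + s)) ?_ ?_
    · exact (by fun_prop : Continuous fun p : E × ℝ => - (l p.1 + p.2)).measurable
    · refine Eventually.of_forall fun w => ?_
      exact ((Measure.measurePreserving_neg volume).comp
        (measurePreserving_add_left volume (l w))).map_eq
  have h2 := (measurePreserving_add_left volume y).comp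
    (Ψ.measurePreserving.comp ((WithLp.volume_preserving_toLp E ℝ).comp h1))
  have heq : (fun p : E × ℝ => y + L p.1 - (l p.1 + p.2) • ν) =
      (fun x => y + x) ∘ Ψ ∘ WithLp.toLp 2 ∘ fun p => (p.1, - (l p.1 + p.2)) := by
    funext p
    simp only [Function.comp_apply, hΨ]
    module
  rw [heq]
  exact h2

end Volume

section Global

variable {n : ℕ} {S : Set (Euc n)} {u : Euc n → Euc n} {κ : Euc n → ℝ}

/-- The pairs of a point of `S` on its boundary and an outer unit normal at this point. -/
def normalBundle (S : Set (Euc n)) : Set (Euc n × Euc n) :=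
  {p | p.1 ∈ frontier S ∧ IsOuterNormalAt S p.1 p.2}

theorem IsSymConvexBody.isCompact_normalBundle (hS : IsSymConvexBody S) :
    IsCompact (normalBundle S) := by
  have hsub : normalBundle S ⊆ S ×ˢ closedBall 0 1 := fun p hp =>
    ⟨hS.frontier_subset hp.1, by rw [mem_closedBall_zero_iff]; exact hp.2.norm_eq.le⟩
  refine (hS.1.prod (isCompact_closedBall _ _)).of_isClosed_subset ?_ hsub
  refine (isClosed_frontier.preimage continuous_fst).inter (IsClosed.inter ?_ ?_)
  · exact isClosed_eq (continuous_norm.comp continuous_snd) continuous_const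
  · have : {p : Euc n × Euc n | ∀ y ∈ S, ⟪y, p.2⟫ ≤ ⟪p.1, p.2⟫}
        = ⋂ y ∈ S, {p | ⟪y, p.2⟫ ≤ ⟪p.1, p.2⟫} := by ext; simp
    change IsClosed {p : Euc n × Euc n | ∀ y ∈ S, ⟪y, p.2⟫ ≤ ⟪p.1, p.2⟫}
    rw [this]
    exact isClosed_biInter fun y _ => isClosed_le (by fun_prop) (by fun_prop)

theorem IsSymConvexBody.exists_ball_subset (hS : IsSymConvexBody S) :
    ∃ r > (0 : ℝ), closedBall 0 r ⊆ S := by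
  obtain ⟨p, hp⟩ := hS.2.2.1
  have hneg : -p ∈ S := by
    rw [hS.2.2.2]
    simpa using interior_subset hp
  have h0 : (0 : Euc n) ∈ interior S := by
    have := hS.2.1.combo_interior_self_mem_interior hp hneg (a := 1 / 2) (b := 1 / 2)
      (by norm_num) (by norm_num) (by norm_num)
    simpa using this
  obtain ⟨r, hr, h⟩ := Metric.nhds_basis_closedBall.mem_iff.1 (mem_interior_iff_mem_nhds.1 h0)
  exact ⟨r, hr, h⟩

theorem IsOuterNormalAt.le_inner {x N : Euc n} {r : ℝ} (hr : 0 < r) (hrS : closedBall 0 r ⊆ S)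
    (hN : IsOuterNormalAt S x N) : r ≤ ⟪x, N⟫ := by
  have h1 : r • N ∈ S := hrS (by simp [norm_smul, hN.norm_eq, abs_of_pos hr])
  have := hN.inner_le h1
  rwa [inner_smul_left, real_inner_self_eq_norm_sq, hN.norm_eq, conj_trivial, one_pow,
    mul_one] at this

theorem finrank_euc_pred (hn : 2 ≤ n) : n = Module.finrank ℝ (Euc (n - 1)) + 1 := by
  rw [finrank_euclideanSpace_fin]; omega

/-- The Hessian matrix at the origin. -/
def hessianMatrix {m : ℕ} (f : Euc m → ℝ) : Matrix (Fin m) (Fin m) ℝ :=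
  Matrix.of fun i j =>
    fderiv ℝ (fderiv ℝ f) 0 (EuclideanSpace.single i 1) (EuclideanSpace.single j 1)

theorem dotProduct_hessianMatrix_mulVec {m : ℕ} (f : Euc m → ℝ) (w : Euc m) :
    w.ofLp ⬝ᵥ (Matrix.mulVec (hessianMatrix f) w.ofLp) = fderiv ℝ (fderiv ℝ f) 0 w w := by
  have hw : w = ∑ i, w i • EuclideanSpace.single i (1 : ℝ) := by
    conv_lhs => rw [← (EuclideanSpace.basisFun (Fin m) ℝ).sum_repr w]
    simp
  conv_rhs => rw [hw]
  simp only [map_sum, map_smul, sum_apply, smul_apply, smul_eq_mul, dotProduct, Matrix.mulVec,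
    hessianMatrix, Matrix.of_apply, Finset.mul_sum]
  refine Finset.sum_comm.trans (Finset.sum_congr rfl fun i _ => Finset.sum_congr rfl fun j _ => ?_)
  ring

section

variable {x ν : Euc n} {L : Euc (n - 1) →ₗᵢ[ℝ] Euc n} {f : Euc (n - 1) → ℝ} {τ : ℝ}

theorem IsGraphChart.isHermitian_hessianMatrix (h : IsGraphChart S x ν L f τ) :
    (hessianMatrix f).IsHermitian := by
  ext i j
  simp [hessianMatrix, h.isSymm_hessian]

theorem IsGraphChart.posSemidef_hessianMatrix (h : IsGraphChart S x ν L f τ)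
    (hS : IsSymConvexBody S) : (hessianMatrix f).PosSemidef := by
  refine Matrix.PosSemidef.of_dotProduct_mulVec_nonneg h.isHermitian_hessianMatrix fun w => ?_
  have := h.hessian_nonneg hS (WithLp.toLp 2 w)
  rwa [← dotProduct_hessianMatrix_mulVec] at this

end

theorem IsC2Body.exists_isGraphChart (hC2 : IsC2Body S u κ) {x : Euc n} (hx : x ∈ frontier S) :
    ∃ (L : Euc (n - 1) →ₗᵢ[ℝ] Euc n) (f : Euc (n - 1) → ℝ) (τ : ℝ),
      IsGraphChart S x (u x) L f τ ∧ κ x = (hessianMatrix f).det :=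
  (hC2 x hx).2.exists_isGraphChart (hC2 x hx).1

theorem IsC2Body.curvature_nonneg (hC2 : IsC2Body S u κ) (hS : IsSymConvexBody S) {x : Euc n}
    (hx : x ∈ frontier S) : 0 ≤ κ x := by
  obtain ⟨L, f, τ, h, hκ⟩ := hC2.exists_isGraphChart hx
  rw [hκ]
  exact (h.posSemidef_hessianMatrix hS).det_nonneg

theorem IsSymConvexBody.volume_toReal_pos (hS : IsSymConvexBody S) : 0 < (volume S).toReal :=
  ENNReal.toReal_pos ((isOpen_interior.measure_pos volume hS.2.2.1).trans_le
    (measure_mono interior_subset)).ne' hS.1.measure_lt_top.ne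

theorem volume_unitBall_toReal_pos (m : ℕ) : 0 < (volume (ball (0 : Euc m) 1)).toReal :=
  ENNReal.toReal_pos (measure_ball_pos volume _ one_pos).ne' measure_ball_lt_top.ne

theorem IsSymConvexBody.cConst_pos (hS : IsSymConvexBody S) : 0 < cConst n S := by
  have := hS.volume_toReal_pos
  have := volume_unitBall_toReal_pos (n - 1)
  unfold cConst
  positivity

theorem IsC2Body.bddAbove_Gfun (hn : 2 ≤ n) (hS : IsSymConvexBody S) (hC2 : IsC2Body S u κ) :
    BddAbove (Gfun S u κ '' frontier S) := by
  have hfr : IsCompact (frontier S) :=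
    hS.1.of_isClosed_subset isClosed_frontier hS.frontier_subset
  obtain ⟨r, hr, hrS⟩ := hS.exists_ball_subset
  have hloc : ∃ C, ∀ x ∈ frontier S, κ x ≤ C := by
    refine hfr.induction_on (p := fun s => ∃ C, ∀ x ∈ s, κ x ≤ C) ⟨0, by simp⟩
      (fun s t hst ⟨C, hC⟩ => ⟨C, fun x hx => hC x (hst hx)⟩)
      (fun s t ⟨C, hC⟩ ⟨D, hD⟩ => ⟨max C D, fun x hx => hx.elim
        (fun h => (hC x h).trans (le_max_left _ _)) fun h => (hD x h).trans (le_max_right _ _)⟩)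
      (fun x hx => ?_)
    obtain ⟨L, f, τ, h, -⟩ := hC2.exists_isGraphChart hx
    obtain ⟨ρ, hρ, C, hC⟩ := h.exists_curvature_le (finrank_euc_pred hn) hS
    refine ⟨ball x ρ ∩ frontier S, Filter.inter_mem (mem_nhdsWithin_of_mem_nhds
      (ball_mem_nhds x hρ)) self_mem_nhdsWithin, C, fun y hy => ?_⟩
    exact (le_abs_self _).trans
      (hC y hy.2 (mem_ball_iff_norm.1 hy.1) (u y) (κ y) (hC2 y hy.2).1 (hC2 y hy.2).2)
  obtain ⟨C, hC⟩ := hloc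
  refine ⟨cConst n S * C ^ ((1 : ℝ) / (n + 1)) / r, ?_⟩
  rintro _ ⟨x, hx, rfl⟩
  have hc := hS.cConst_pos
  have hκ0 := hC2.curvature_nonneg hS hx
  have hrx := (hC2 x hx).1.le_inner hr hrS
  have hC0 : 0 ≤ C := hκ0.trans (hC x hx)
  unfold Gfun
  gcongr
  exact hC x hx

theorem IsC2Body.exists_curvature_pos (hn : 2 ≤ n) (hS : IsSymConvexBody S)
    (hC2 : IsC2Body S u κ) : ∃ x ∈ frontier S, 0 < κ x := by
  obtain ⟨r, hr, hrS⟩ := hS.exists_ball_subset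
  obtain ⟨x, hxS, hmax⟩ := hS.1.exists_isMaxOn ⟨0, hrS (by simp [hr.le])⟩
    continuous_norm.continuousOn
  have hmax : ∀ y ∈ S, ‖y‖ ≤ ‖x‖ := hmax
  have hn0 : Nontrivial (Euc n) := by
    have : Nonempty (Fin n) := ⟨⟨0, by omega⟩⟩
    infer_instance
  have hR : 0 < ‖x‖ := by
    obtain ⟨e, he⟩ := exists_norm_eq (Euc n) hr.le
    exact hr.trans_le (he ▸ hmax e (hrS (by simp [he])))
  have hxfr : x ∈ frontier S := by
    refine ⟨subset_closure hxS, fun hint => ?_⟩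
    have hc : ContinuousAt (fun s : ℝ => s • x) 1 := by fun_prop
    have hev : ∀ᶠ s in 𝓝 (1 : ℝ), s • x ∈ S := by
      refine hc.eventually ?_
      simpa using mem_interior_iff_mem_nhds.1 hint
    obtain ⟨s, hs, hs0⟩ := ((hev.filter_mono nhdsWithin_le_nhds).and
      (self_mem_nhdsWithin (a := (1 : ℝ)) (s := Ioi 1))).exists
    have hs0 : 1 < s := hs0
    have := hmax _ hs
    rw [norm_smul, Real.norm_of_nonneg (by linarith)] at this
    nlinarith
  obtain ⟨L, f, τ, h, hκ⟩ := hC2.exists_isGraphChart hxfr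
  refine ⟨x, hxfr, ?_⟩
  have hux : u x = ‖x‖⁻¹ • x := by
    refine (h.eq_normal (finrank_euc_pred hn) hS ⟨by simp [norm_smul, hR.ne'], fun y hy => ?_⟩).symm
    rw [inner_smul_right, inner_smul_right]
    refine mul_le_mul_of_nonneg_left ?_ (by positivity)
    rw [real_inner_self_eq_norm_sq]
    nlinarith [real_inner_le_norm y x, hmax y hy]
  have hxu : x = ‖x‖ • u x := by rw [hux, smul_smul, mul_inv_cancel₀ hR.ne', one_smul]
  have hpos : (hessianMatrix f).PosDef := by
    refine Matrix.PosDef.of_dotProduct_mulVec_pos h.isHermitian_hessianMatrix fun w hw => ?_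
    change 0 < w ⬝ᵥ _
    set v : Euc (n - 1) := WithLp.toLp 2 w
    have hv : 0 < ‖v‖ := norm_pos_iff.2 (by simpa [v] using hw)
    have e := dotProduct_hessianMatrix_mulVec f v
    change w ⬝ᵥ _ = _ at e
    rw [e]
    refine lt_of_lt_of_le ?_ (h.le_hessian (a := ‖v‖ ^ 2 / (2 * ‖x‖)) ?_)
    · positivity
    · filter_upwards [eventually_smul_mem_ball h.pos v] with t ht
      have h1 := hmax _ (hS.frontier_subset (h.mem_frontier _ ht))
      have h2 := pow_le_pow_left₀ (norm_nonneg _) h1 2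
      have h3 : x + L (t • v) - f (t • v) • u x = L (t • v) + (‖x‖ - f (t • v)) • u x := by
        rw [sub_smul, ← hxu]
        abel
      rw [h3, norm_add_sq_real, inner_smul_right, h.orth, L.norm_map, norm_smul, norm_smul,
        h.normal.norm_eq, mul_one, Real.norm_eq_abs, Real.norm_eq_abs, sq_abs, mul_pow,
        sq_abs] at h2
      rw [div_mul_eq_mul_div, div_le_iff₀ (by positivity)]
      nlinarith [sq_nonneg (f (t • v))]
  rw [hκ]
  exact hpos.det_pos

theorem IsC2Body.Gfun_le_sSup (hn : 2 ≤ n) (hS : IsSymConvexBody S) (hC2 : IsC2Body S u κ)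
    {x : Euc n} (hx : x ∈ frontier S) : Gfun S u κ x ≤ sSup (Gfun S u κ '' frontier S) :=
  le_csSup (hC2.bddAbove_Gfun hn hS) (mem_image_of_mem _ hx)

theorem IsC2Body.sSup_Gfun_pos (hn : 2 ≤ n) (hS : IsSymConvexBody S) (hC2 : IsC2Body S u κ) :
    0 < sSup (Gfun S u κ '' frontier S) := by
  obtain ⟨r, hr, hrS⟩ := hS.exists_ball_subset
  obtain ⟨x, hx, hκ⟩ := hC2.exists_curvature_pos hn hS
  refine lt_of_lt_of_le ?_ (hC2.Gfun_le_sSup hn hS hx)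
  have h1 := hr.trans_le ((hC2 x hx).1.le_inner hr hrS)
  have h2 := hS.cConst_pos
  unfold Gfun
  positivity

end Global

section Assembly

variable {n : ℕ} {S : Set (Euc n)} {u : Euc n → Euc n} {κ : Euc n → ℝ}

theorem mul_lt_paraboloid_volume (hn : 2 ≤ n) {V β d δ X : ℝ} (hV : 0 < V) (hβ : 0 < β)
    (hd : 0 < d) (hδ : 0 < δ)
    (h : ((n + 1 : ℝ) ^ ((2 : ℝ) / (n + 1)) / 2) * (V / β) ^ ((2 : ℝ) / (n + 1)) *
      (d ^ 2) ^ ((1 : ℝ) / (n + 1)) < X) :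
    δ * V < d⁻¹ * β * 2 ^ (((n - 1 : ℕ) : ℝ) / 2) *
      (X * δ ^ ((2 : ℝ) / (n + 1))) ^ (((n - 1 : ℕ) : ℝ) / 2 + 1) /
        (((n - 1 : ℕ) : ℝ) / 2 + 1) := by
  have hN : (0 : ℝ) < n + 1 := by positivity
  set q : ℝ := ((n : ℝ) + 1) / 2 with hq
  have hq0 : 0 < q := by positivity
  have e1 : ((n - 1 : ℕ) : ℝ) / 2 + 1 = q := by
    rw [Nat.cast_sub (by omega)]; push_cast; ring
  have e2 : ((n - 1 : ℕ) : ℝ) / 2 = q - 1 := by linarith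
  rw [e1, e2]
  have ep : (2 : ℝ) / (n + 1) * q = 1 := by rw [hq]; field_simp
  have ep' : (1 : ℝ) / (n + 1) * q = 1 / 2 := by rw [hq]; field_simp
  have hX : 0 < X := lt_of_le_of_lt (by positivity) h
  have h2 := Real.rpow_lt_rpow (by positivity) h hq0
  rw [Real.mul_rpow (by positivity) (by positivity), Real.mul_rpow (by positivity) (by positivity),
    Real.div_rpow (by positivity) (by positivity), ← Real.rpow_mul (by positivity),
    ← Real.rpow_mul (by positivity), ← Real.rpow_mul (by positivity), ep, ep', Real.rpow_one,
    Real.rpow_one, ← Real.sqrt_eq_rpow, Real.sqrt_sq hd.le] at h2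
  rw [Real.mul_rpow hX.le (by positivity), ← Real.rpow_mul hδ.le, ep, Real.rpow_one,
    Real.rpow_sub_one (by norm_num)]
  have h3 : (0 : ℝ) < 2 ^ q := by positivity
  have h4 : δ * V = d⁻¹ * β * (2 ^ q / 2) * (((n : ℝ) + 1) / 2 ^ q * (V / β) * d * δ) / q := by
    rw [hq]
    field_simp
  rw [h4]
  gcongr

theorem IsSymConvexBody.paraboloid_volume_le_cap {E : Type*} [NormedAddCommGroup E]
    [InnerProductSpace ℝ E] [FiniteDimensional ℝ E] [MeasurableSpace E] [BorelSpace E]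
    (hn : n = Module.finrank ℝ E + 1) (hS : IsSymConvexBody S) {L : E →ₗᵢ[ℝ] Euc n}
    {ν N y : Euc n} (hν : ‖ν‖ = 1) (hL : ∀ v, ⟪L v, ν⟫ = 0) (hN : ‖N‖ = 1) {l : E →L[ℝ] ℝ}
    (hl : ∀ w, ⟪L w, N⟫ = l w * ⟪ν, N⟫) {q : E → ℝ} (hq : ∀ w, 0 ≤ q w) {t : ℝ}
    (hsub : ∀ w s, q w ≤ s → s ≤ t → y + L w - (l w + s) • ν ∈ S) :
    volume {p : E × ℝ | q p.1 ≤ p.2 ∧ p.2 ≤ t} ≤ volume (S ∩ {z | ⟪N, y⟫ - t ≤ ⟪N, z⟫}) := by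
  have hmp := measurePreserving_shear_frame (by simpa using hn) L hν hL y l
  have hmeas : MeasurableSet (S ∩ {z | ⟪N, y⟫ - t ≤ ⟪N, z⟫}) :=
    (hS.isClosed.inter (isClosed_le (by fun_prop) (by fun_prop))).measurableSet
  rw [← hmp.measure_preimage hmeas.nullMeasurableSet]
  refine measure_mono fun p hp => ⟨hsub p.1 p.2 hp.1 hp.2, ?_⟩
  have h1 : ⟪N, L p.1⟫ = l p.1 * ⟪N, ν⟫ := by
    rw [real_inner_comm, hl, real_inner_comm]
  have h2 : ⟪N, ν⟫ ≤ 1 := by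
    simpa [hN, hν] using real_inner_le_norm N ν
  have h3 : 0 ≤ p.2 := (hq _).trans hp.1
  change ⟪N, y⟫ - t ≤ ⟪N, y + L p.1 - (l p.1 + p.2) • ν⟫
  rw [inner_sub_right, inner_add_right, inner_smul_right, h1]
  nlinarith [hp.2, mul_le_mul_of_nonneg_left h2 h3]

theorem exists_linearMap_norm_sq_eq {m : ℕ} {A : Matrix (Fin m) (Fin m) ℝ} (hA : A.PosDef) :
    ∃ T : Euc m →ₗ[ℝ] Euc m, LinearMap.det T ^ 2 = A.det ∧
      ∀ w : Euc m, ‖T w‖ ^ 2 = w.ofLp ⬝ᵥ (Matrix.mulVec A w.ofLp) := by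
  obtain ⟨B, rfl⟩ := by
    open scoped MatrixOrder in
    exact CStarAlgebra.nonneg_iff_eq_star_mul_self.1 hA.posSemidef.nonneg
  refine ⟨Matrix.toLpLin 2 2 B, ?_, fun w => ?_⟩
  · rw [LinearMap.det_toLpLin, Matrix.det_mul, Matrix.star_eq_conjTranspose,
      Matrix.det_conjTranspose, star_trivial, sq]
  · rw [Matrix.toLpLin_apply, EuclideanSpace.real_norm_sq_eq, ← Matrix.mulVec_mulVec,
      Matrix.dotProduct_mulVec, Matrix.star_eq_conjTranspose,
      Matrix.conjTranspose_eq_transpose_of_trivial, Matrix.vecMul_transpose]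
    simp [dotProduct, sq]

theorem exists_nonneg_tendsto_of_forall_pos {P : ℝ → ℝ → Prop}
    (h : ∀ ε > 0, ∃ d > (0 : ℝ), ∀ δ, 0 < δ → δ < d → P ε δ) :
    ∃ Φ : ℝ → ℝ, (∀ δ, 0 ≤ Φ δ) ∧ Tendsto Φ (𝓝[>] 0) (𝓝 0) ∧
      ∃ δ₀ > (0 : ℝ), ∀ δ, 0 < δ → δ < δ₀ → P (Φ δ) δ := by
  set A : ℝ → Set ℝ := fun δ => {ε | 0 < ε ∧ P ε δ}
  have hbdd : ∀ δ, BddBelow (A δ) := fun δ => ⟨0, fun ε hε => hε.1.le⟩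
  have hsel : ∀ δ, ∃ ε, 0 ≤ ε ∧ (0 < δ → (A δ).Nonempty → P ε δ ∧ ε < sInf (A δ) + δ) := by
    intro δ
    by_cases hδ : 0 < δ ∧ (A δ).Nonempty
    · obtain ⟨ε, hε, hlt⟩ := exists_lt_of_csInf_lt hδ.2 (lt_add_of_pos_right (sInf (A δ)) hδ.1)
      exact ⟨ε, hε.1.le, fun _ _ => ⟨hε.2, hlt⟩⟩
    · exact ⟨0, le_rfl, fun h1 h2 => absurd ⟨h1, h2⟩ hδ⟩
  choose Φ hΦ0 hΦ using hsel
  refine ⟨Φ, hΦ0, ?_, ?_⟩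
  · rw [Metric.tendsto_nhds]
    intro ε hε
    obtain ⟨d, hd, hP⟩ := h (ε / 2) (by positivity)
    filter_upwards [self_mem_nhdsWithin (a := (0 : ℝ)) (s := Ioi 0),
      mem_nhdsWithin_of_mem_nhds (Iio_mem_nhds (lt_min hd (half_pos hε)))] with δ hδ hδd
    have hmem : ε / 2 ∈ A δ := ⟨by positivity, hP δ hδ (hδd.trans_le (min_le_left _ _))⟩
    have h1 := (hΦ δ hδ ⟨_, hmem⟩).2
    have h2 := csInf_le (hbdd δ) hmem
    have h3 : δ < ε / 2 := hδd.trans_le (min_le_right _ _)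
    rw [Real.dist_eq, sub_zero, abs_of_nonneg (hΦ0 δ)]
    linarith
  · obtain ⟨d, hd, hP⟩ := h 1 one_pos
    exact ⟨d, hd, fun δ h0 h1 => (hΦ δ h0 ⟨1, one_pos, hP δ h0 h1⟩).1⟩

theorem exists_mul_rpow_lt (c : ℝ) {p t : ℝ} (hp : 0 < p) (ht : 0 < t) :
    ∃ d > (0 : ℝ), ∀ δ, 0 < δ → δ < d → c * δ ^ p < t := by
  have hc : ContinuousAt (fun δ : ℝ => c * δ ^ p) 0 :=
    continuousAt_const.mul (Real.continuousAt_rpow_const _ _ (Or.inr hp.le))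
  have h0 : c * (0 : ℝ) ^ p < t := by rwa [Real.zero_rpow hp.ne', mul_zero]
  obtain ⟨d, hd, hdb⟩ := Metric.eventually_nhds_iff_ball.1 (hc.eventually (gt_mem_nhds h0))
  exact ⟨d, hd, fun δ h1 h2 => hdb δ (by simpa [abs_of_pos h1] using h2)⟩

theorem IsC2Body.exists_nhds_mul_volume_lt (hn : 2 ≤ n) (hS : IsSymConvexBody S)
    (hC2 : IsC2Body S u κ) {ε : ℝ} (hε : 0 < ε) {p : Euc n × Euc n} (hp : p ∈ normalBundle S) :
    ∃ U ∈ 𝓝[normalBundle S] p, ∃ d > (0 : ℝ), ∀ δ, 0 < δ → δ < d → ∀ q ∈ U,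
      ENNReal.ofReal δ * volume S < volume (S ∩ {z | (1 - (1 + ε) *
        sSup (Gfun S u κ '' frontier S) * δ ^ ((2 : ℝ) / (n + 1))) * ⟪q.2, q.1⟫ ≤ ⟪q.2, z⟫}) := by
  obtain ⟨x₀, N₀⟩ := p
  have hx₀ : x₀ ∈ frontier S := hp.1
  obtain ⟨L, f, τ, h, hκ⟩ := hC2.exists_isGraphChart hx₀
  obtain rfl : N₀ = u x₀ := h.eq_normal (finrank_euc_pred hn) hS hp.2
  obtain ⟨r, hr, hrS⟩ := hS.exists_ball_subset
  set G := sSup (Gfun S u κ '' frontier S) with hG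
  have hG0 : 0 < G := hC2.sSup_Gfun_pos hn hS
  have hh₀ : 0 < ⟪x₀, u x₀⟫ := hr.trans_le (h.normal.le_inner hr hrS)
  have hlt : cConst n S * (hessianMatrix f + (0 : ℝ) • 1).det ^ ((1 : ℝ) / (n + 1)) <
      (1 + ε) * G * ⟪u x₀, x₀⟫ := by
    rw [zero_smul, add_zero, ← hκ, real_inner_comm]
    have := hC2.Gfun_le_sSup hn hS hx₀
    rw [Gfun, div_le_iff₀ hh₀] at this
    nlinarith [mul_pos hε (mul_pos hG0 hh₀)]
  have hdet : ContinuousAt (fun η : ℝ =>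
      cConst n S * (hessianMatrix f + η • 1).det ^ ((1 : ℝ) / (n + 1))) 0 := by
    refine continuousAt_const.mul (ContinuousAt.rpow_const ?_ (Or.inr (by positivity)))
    exact (continuous_const.add (continuous_id.smul continuous_const)).matrix_det.continuousAt
  obtain ⟨η, hη, hη0⟩ := (((hdet.eventually (gt_mem_nhds hlt)).filter_mono
    nhdsWithin_le_nhds).and (self_mem_nhdsWithin (a := (0 : ℝ)) (s := Ioi 0))).exists
  have hη0 : 0 < η := hη0
  obtain ⟨ρ, hρ, t₀, ht₀, hpar⟩ := h.exists_paraboloid_subset (finrank_euc_pred hn) hS hη0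
  have hA : (hessianMatrix f + η • 1).PosDef :=
    Matrix.PosDef.posSemidef_add (h.posSemidef_hessianMatrix hS) (Matrix.PosDef.one.smul hη0)
  obtain ⟨T, hT, hTq⟩ := exists_linearMap_norm_sq_eq hA
  have hT0 : LinearMap.det T ≠ 0 := fun h0 => by
    have := hA.det_pos
    rw [← hT, h0] at this
    simp at this
  have hTq' : ∀ w, ‖T w‖ ^ 2 = fderiv ℝ (fderiv ℝ f) 0 w w + η * ‖w‖ ^ 2 := fun w => by
    rw [hTq, Matrix.add_mulVec, dotProduct_add, dotProduct_hessianMatrix_mulVec,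
      Matrix.smul_mulVec, Matrix.one_mulVec, dotProduct_smul, EuclideanSpace.real_norm_sq_eq]
    simp [dotProduct, sq]
  have hinner : Continuous fun q : Euc n × Euc n => ⟪q.2, q.1⟫ := by fun_prop
  have hev : ∀ᶠ q in 𝓝 (x₀, u x₀), ‖q.1 - x₀‖ < ρ ∧
      cConst n S * (hessianMatrix f + η • 1).det ^ ((1 : ℝ) / (n + 1)) <
        (1 + ε) * G * ⟪q.2, q.1⟫ ∧ ⟪q.2, q.1⟫ < ⟪u x₀, x₀⟫ + 1 := by
    refine Eventually.and ?_ (Eventually.and ?_ ?_)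
    · exact (continuous_fst.continuousAt (x := (x₀, u x₀))).eventually_norm_sub_lt hρ
    · exact (continuousAt_const.mul hinner.continuousAt).eventually (lt_mem_nhds hη)
    · exact hinner.continuousAt.eventually (gt_mem_nhds (lt_add_one _))
  obtain ⟨d, hd, hdb⟩ := exists_mul_rpow_lt ((1 + ε) * G * (⟪u x₀, x₀⟫ + 1))
    (p := (2 : ℝ) / (n + 1)) (by positivity) ht₀
  refine ⟨_, Filter.inter_mem (mem_nhdsWithin_of_mem_nhds hev) self_mem_nhdsWithin, d, hd, ?_⟩
  rintro δ hδ hδd ⟨y, N⟩ ⟨⟨hyρ, hc, hyh⟩, hy, hN⟩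
  simp only at hyρ hc hyh hN hy ⊢
  obtain ⟨l, -, hl, hsub⟩ := hpar y hy hyρ N hN
  set X := (1 + ε) * G * ⟪N, y⟫ with hX
  set t := X * δ ^ ((2 : ℝ) / (n + 1)) with ht
  have hyN : 0 < ⟪N, y⟫ := by
    rw [real_inner_comm]
    exact hr.trans_le (hN.le_inner hr hrS)
  have ht0 : 0 < t := by positivity
  have htt : t ≤ t₀ := by
    refine le_trans ?_ (hdb δ hδ hδd).le
    rw [ht, hX]
    gcongr
  have hcap := hS.paraboloid_volume_le_cap (finrank_euc_pred hn) h.normal.norm_eq h.orth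
    hN.norm_eq hl (q := fun w => ‖T w‖ ^ 2 / 2) (fun w => by positivity) (t := t)
    fun w s hs hst => hsub w s (by rw [← hTq']; exact hs) (hst.trans htt)
  rw [volume_paraboloid T hT0 ht0.le, finrank_euclideanSpace_fin] at hcap
  have hVol := hS.volume_toReal_pos
  have hreal := mul_lt_paraboloid_volume hn hVol (volume_unitBall_toReal_pos (n - 1))
    (abs_pos.2 hT0) hδ (X := X) (by rw [sq_abs, hT]; exact hc)
  have e : (1 - (1 + ε) * G * δ ^ ((2 : ℝ) / (n + 1))) * ⟪N, y⟫ = ⟪N, y⟫ - t := by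
    rw [ht, hX]; ring
  rw [e]
  refine lt_of_lt_of_le ?_ hcap
  rw [← ENNReal.ofReal_toReal hS.1.measure_lt_top.ne, ← ENNReal.ofReal_mul hδ.le]
  exact (ENNReal.ofReal_lt_ofReal_iff_of_nonneg (by positivity)).2 hreal

theorem IsSymConvexBody.exists_mem_normalBundle (hS : IsSymConvexBody S) {N : Euc n}
    (hN : ‖N‖ = 1) : ∃ y, (y, N) ∈ normalBundle S := by
  obtain ⟨y, hyS, hmax⟩ := hS.1.exists_isMaxOn (hS.2.2.1.mono interior_subset)
    (f := fun z => ⟪z, N⟫) (by fun_prop)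
  refine ⟨y, ⟨subset_closure hyS, fun hint => ?_⟩, hN, hmax⟩
  have hc : ContinuousAt (fun s : ℝ => y + s • N) 0 := by fun_prop
  have hev : ∀ᶠ s in 𝓝 (0 : ℝ), y + s • N ∈ S := by
    refine hc.eventually ?_
    simpa using mem_interior_iff_mem_nhds.1 hint
  obtain ⟨s, hs, hs0⟩ := ((hev.filter_mono nhdsWithin_le_nhds).and
    (self_mem_nhdsWithin (a := (0 : ℝ)) (s := Ioi 0))).exists
  have hs0 : 0 < s := hs0
  have := hmax hs
  simp only [mem_ofPred_eq, inner_add_left, inner_smul_left, real_inner_self_eq_norm_sq, hN,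
    conj_trivial] at this
  linarith

theorem IsSymConvexBody.smul_subset_floatingBody (hS : IsSymConvexBody S) {a δ : ℝ} (ha : 0 ≤ a)
    (h : ∀ q ∈ normalBundle S, ENNReal.ofReal δ * volume S <
      volume (S ∩ {z | a * ⟪q.2, q.1⟫ ≤ ⟪q.2, z⟫})) : a • S ⊆ floatingBody S δ := by
  rintro _ ⟨x, hx, rfl⟩
  simp only [floatingBody, mem_iInter]
  intro v hv c hc
  change ⟪v, a • x⟫ ≤ c
  by_contra! hlt
  have hv' : 0 < ‖v‖ := norm_pos_iff.2 hv
  obtain ⟨y, hy⟩ := hS.exists_mem_normalBundle (N := ‖v‖⁻¹ • v) (by simp [norm_smul, hv'.ne'])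
  refine (h _ hy).not_ge (le_trans (measure_mono ?_) hc)
  have hvy := hy.2.inner_le hx
  simp only [inner_smul_right] at hvy
  have hvy := le_of_mul_le_mul_left hvy (inv_pos.2 hv')
  rintro z ⟨hzS, hz⟩
  refine ⟨hzS, ?_⟩
  simp only [mem_ofPred_eq, inner_smul_left, conj_trivial] at hz ⊢
  rw [mul_left_comm] at hz
  have hz := le_of_mul_le_mul_left hz (inv_pos.2 hv')
  rw [inner_smul_right, real_inner_comm] at hlt
  rw [real_inner_comm] at hz
  nlinarith [mul_le_mul_of_nonneg_left hvy ha]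

theorem IsC2Body.exists_smul_subset_floatingBody (hn : 2 ≤ n) (hS : IsSymConvexBody S)
    (hC2 : IsC2Body S u κ) {ε : ℝ} (hε : 0 < ε) :
    ∃ d > (0 : ℝ), ∀ δ, 0 < δ → δ < d →
      (1 - (1 + ε) * sSup (Gfun S u κ '' frontier S) * δ ^ ((2 : ℝ) / (n + 1))) • S ⊆
        floatingBody S δ := by
  obtain ⟨d₁, hd₁, h₁⟩ := hS.isCompact_normalBundle.induction_on
    (p := fun U => ∃ d > (0 : ℝ), ∀ δ, 0 < δ → δ < d → ∀ q ∈ U,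
      ENNReal.ofReal δ * volume S < volume (S ∩ {z | (1 - (1 + ε) *
        sSup (Gfun S u κ '' frontier S) * δ ^ ((2 : ℝ) / (n + 1))) * ⟪q.2, q.1⟫ ≤ ⟪q.2, z⟫}))
    ⟨1, one_pos, by simp⟩
    (fun _ _ hst ⟨d, hd, hd'⟩ => ⟨d, hd, fun δ h0 h1 q hq => hd' δ h0 h1 q (hst hq)⟩)
    (fun _ _ ⟨d, hd, hd'⟩ ⟨e, he, he'⟩ => ⟨min d e, lt_min hd he, fun δ h0 h1 q hq => hq.elim
      (hd' δ h0 (h1.trans_le (min_le_left _ _)) q)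
      (he' δ h0 (h1.trans_le (min_le_right _ _)) q)⟩)
    (fun p hp => hC2.exists_nhds_mul_volume_lt hn hS hε hp)
  obtain ⟨d₂, hd₂, h₂⟩ := exists_mul_rpow_lt ((1 + ε) * sSup (Gfun S u κ '' frontier S))
    (p := (2 : ℝ) / (n + 1)) (by positivity) one_pos
  refine ⟨min d₁ d₂, lt_min hd₁ hd₂, fun δ h0 h1 => hS.smul_subset_floatingBody ?_ ?_⟩
  · have := h₂ δ h0 (h1.trans_le (min_le_right _ _))
    linarith
  · exact h₁ δ h0 (h1.trans_le (min_le_left _ _))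

end Assembly

/-- Proposition 3.2: for a centrally symmetric convex body `S` with `C²` boundary there is a
nonnegative function `Φ` with `Φ(δ) → 0` as `δ → 0` such that
`(1 − (1+Φ(δ))·G_max·δ^{2/(n+1)})·S ⊆ S_δ` for all small `δ > 0`. -/
theorem statement5 {n : ℕ} (hn : 2 ≤ n) (S : Set (Euc n))
    (u : Euc n → Euc n) (κ : Euc n → ℝ)
    (hS : IsSymConvexBody S) (hC2 : IsC2Body S u κ) :
    ∃ Φ : ℝ → ℝ, (∀ δ, 0 ≤ Φ δ) ∧ Tendsto Φ (𝓝[>] 0) (𝓝 0) ∧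
      ∃ δ₀ > (0:ℝ), ∀ δ : ℝ, 0 < δ → δ < δ₀ →
        (1 - (1 + Φ δ) * sSup (Gfun S u κ '' frontier S) * δ ^ ((2:ℝ)/(n+1))) • S
          ⊆ floatingBody S δ := by
  exact exists_nonneg_tendsto_of_forall_pos fun ε hε =>
    hC2.exists_smul_subset_floatingBody hn hS hε
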